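/- The angular momentum operator L on the quantum-plane monomial module V satisfies the quantum mechanical commutation relations [L, X̂] = iℏ·Ŷ, [L, Ŷ] = −iℏ·X̂, [L, P_x] = iℏ·P_y, and [L, P_y] = −iℏ·P_x. -/

import Mathlib

noncomputable section

/-- The quantum-plane monomial module: finitely supported functions `ℕ × ℕ → ℂ`,
with basis vector `e(n,m)` thought of as the monomial `z₊ⁿ z₋ᵐ`. -/
abbrev V : Type := (ℕ × ℕ) →₀ ℂ

/-- The `p`-integer `[k]_p = (1 − pᵏ)/(1 − p)`. -/
def qint (p : ℂ) (k : ℕ) : ℂ := (1 - p ^ k) / (1 - p)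

/-- Right multiplication by `z₊`: `Ẑ₊ e(n,m) = q^{2m} e(n+1,m)`. -/
def Zp (q : ℝ) : V →ₗ[ℂ] V :=
  Finsupp.lsum ℂ fun nm => ((q : ℂ) ^ (2 * nm.2)) • Finsupp.lsingle (nm.1 + 1, nm.2)

/-- Right multiplication by `z₋`: `Ẑ₋ e(n,m) = e(n,m+1)`. -/
def Zm : V →ₗ[ℂ] V :=
  Finsupp.lsum ℂ fun nm => Finsupp.lsingle (nm.1, nm.2 + 1)

/-- `P₊ e(n,m) = iℏ [n]_{q⁻²} e(n−1,m)` (the `n = 0` term vanishes since `[0] = 0`). -/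
def Pp (q ℏ : ℝ) : V →ₗ[ℂ] V :=
  Finsupp.lsum ℂ fun nm =>
    (Complex.I * (ℏ : ℂ) * qint (((q : ℂ) ^ 2)⁻¹) nm.1) • Finsupp.lsingle (nm.1 - 1, nm.2)

/-- `P₋ e(n,m) = iℏ q^{−2n} [m]_{q²} e(n,m−1)` (the `m = 0` term vanishes since `[0] = 0`). -/
def Pm (q ℏ : ℝ) : V →ₗ[ℂ] V :=
  Finsupp.lsum ℂ fun nm =>
    (Complex.I * (ℏ : ℂ) * ((q : ℂ) ^ (2 * nm.1))⁻¹ * qint ((q : ℂ) ^ 2) nm.2) •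
      Finsupp.lsingle (nm.1, nm.2 - 1)

/-- The angular momentum operator `L e(n,m) = ℏ (n − m) e(n,m)`. -/
def Lop (ℏ : ℝ) : V →ₗ[ℂ] V :=
  Finsupp.lsum ℂ fun nm => ((ℏ : ℂ) * ((nm.1 : ℂ) - (nm.2 : ℂ))) • Finsupp.lsingle nm

/-- The diagonal operator `Q e(n,m) = q^{2(m−n)} e(n,m)`, i.e. `Q = exp((2Λ/ℏ)·L)`. -/
def Qop (q : ℝ) : V →ₗ[ℂ] V :=
  Finsupp.lsum ℂ fun nm =>
    ((q : ℂ) ^ (2 * nm.2) * ((q : ℂ) ^ (2 * nm.1))⁻¹) • Finsupp.lsingle nm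

/-- `X̂ = (Ẑ₊ + Ẑ₋)/√2`. -/
def Xop (q : ℝ) : V →ₗ[ℂ] V := ((Real.sqrt 2 : ℂ))⁻¹ • (Zp q + Zm)

/-- `Ŷ = (Ẑ₊ − Ẑ₋)/(√2 i)`. -/
def Yop (q : ℝ) : V →ₗ[ℂ] V := (((Real.sqrt 2 : ℂ)) * Complex.I)⁻¹ • (Zp q - Zm)

/-- `P_x = (P₊ + P₋)/√2`. -/
def Px (q ℏ : ℝ) : V →ₗ[ℂ] V := ((Real.sqrt 2 : ℂ))⁻¹ • (Pp q ℏ + Pm q ℏ)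

/-- `P_y = i (P₊ − P₋)/√2`. -/
def Py (q ℏ : ℝ) : V →ₗ[ℂ] V := (Complex.I / (Real.sqrt 2 : ℂ)) • (Pp q ℏ - Pm q ℏ)


lemma Lop_single (ℏ : ℝ) (n m : ℕ) (c : ℂ) :
    Lop ℏ (Finsupp.single (n, m) c) = ((ℏ : ℂ) * ((n : ℂ) - m)) • Finsupp.single (n, m) c := by
  simp [Lop]

/-- `[L, Ẑ₊] = ℏ Ẑ₊`. -/
lemma Lop_comp_Zp (q ℏ : ℝ) : Lop ℏ ∘ₗ Zp q = Zp q ∘ₗ Lop ℏ + (ℏ : ℂ) • Zp q := by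
  refine Finsupp.lhom_ext fun ⟨n, m⟩ c => ?_
  simp only [LinearMap.comp_apply, LinearMap.add_apply, LinearMap.smul_apply, Lop_single, map_smul]
  simp only [Zp, Finsupp.lsum_single, LinearMap.smul_apply, Finsupp.lsingle_apply, map_smul,
    Lop_single]
  push_cast
  module

/-- `[L, Ẑ₋] = -ℏ Ẑ₋`. -/
lemma Lop_comp_Zm (ℏ : ℝ) : Lop ℏ ∘ₗ Zm = Zm ∘ₗ Lop ℏ - (ℏ : ℂ) • Zm := by
  refine Finsupp.lhom_ext fun ⟨n, m⟩ c => ?_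
  simp only [LinearMap.comp_apply, LinearMap.sub_apply, LinearMap.smul_apply, Lop_single, map_smul]
  simp only [Zm, Finsupp.lsum_single, Finsupp.lsingle_apply, Lop_single]
  push_cast
  module

lemma qint_zero (p : ℂ) : qint p 0 = 0 := by simp [qint]

/-- `[L, P₊] = -ℏ P₊`. -/
lemma Lop_comp_Pp (q ℏ : ℝ) : Lop ℏ ∘ₗ Pp q ℏ = Pp q ℏ ∘ₗ Lop ℏ - (ℏ : ℂ) • Pp q ℏ := by
  refine Finsupp.lhom_ext fun ⟨n, m⟩ c => ?_
  simp only [LinearMap.comp_apply, LinearMap.sub_apply, LinearMap.smul_apply, Lop_single, map_smul]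
  simp only [Pp, Finsupp.lsum_single, LinearMap.smul_apply, Finsupp.lsingle_apply, map_smul,
    Lop_single]
  cases n with
  | zero => simp [qint_zero]
  | succ n =>
    simp only [Nat.add_sub_cancel]
    push_cast
    module

/-- `[L, P₋] = ℏ P₋`. -/
lemma Lop_comp_Pm (q ℏ : ℝ) : Lop ℏ ∘ₗ Pm q ℏ = Pm q ℏ ∘ₗ Lop ℏ + (ℏ : ℂ) • Pm q ℏ := by
  refine Finsupp.lhom_ext fun ⟨n, m⟩ c => ?_
  simp only [LinearMap.comp_apply, LinearMap.add_apply, LinearMap.smul_apply, Lop_single, map_smul]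
  simp only [Pm, Finsupp.lsum_single, LinearMap.smul_apply, Finsupp.lsingle_apply, map_smul,
    Lop_single]
  cases m with
  | zero => simp [qint_zero]
  | succ m =>
    simp only [Nat.add_sub_cancel]
    push_cast
    module

/-- The angular momentum operator `L` on the quantum-plane monomial module
satisfies `[L, X̂] = iℏ Ŷ`, `[L, Ŷ] = −iℏ X̂`, `[L, P_x] = iℏ P_y`, `[L, P_y] = −iℏ P_x`. -/
theorem angular_momentum_commutators (q ℏ : ℝ) (hq0 : 0 < q) (hq1 : q < 1) (hℏ : 0 < ℏ) :
    Lop ℏ ∘ₗ Xop q - Xop q ∘ₗ Lop ℏ = (Complex.I * (ℏ : ℂ)) • Yop q ∧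
    Lop ℏ ∘ₗ Yop q - Yop q ∘ₗ Lop ℏ = (-(Complex.I) * (ℏ : ℂ)) • Xop q ∧
    Lop ℏ ∘ₗ Px q ℏ - Px q ℏ ∘ₗ Lop ℏ = (Complex.I * (ℏ : ℂ)) • Py q ℏ ∧
    Lop ℏ ∘ₗ Py q ℏ - Py q ℏ ∘ₗ Lop ℏ = (-(Complex.I) * (ℏ : ℂ)) • Px q ℏ := by
  refine ⟨?_, ?_, ?_, ?_⟩ <;>
  simp only [Xop, Yop, Px, Py, LinearMap.comp_smul, LinearMap.smul_comp, LinearMap.comp_add,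
    LinearMap.add_comp, LinearMap.comp_sub, LinearMap.sub_comp, Lop_comp_Zp, Lop_comp_Zm,
    Lop_comp_Pp, Lop_comp_Pm, mul_inv, Complex.inv_I, div_eq_mul_inv] <;>
  match_scalars <;> grind [Complex.I_mul_I]

end
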